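/- arXiv:1510.04195 — 7 statements merged into one kernel-verified Lean document; each statement's English description precedes it below -/
import Mathlib

section
/- If f and g are in addition bounded and Ψ(P; f, g) = 0, then Measure.map f P = Measure.map g P. Equivalently, Ψ(P; f, g) > 0 whenever the laws of f and g under P differ. -/
open MeasureTheory Real

/-- `Φ(P; f, g) = ∫∫ exp(−(f(ω₁) − g(ω₂))²) dP(ω₁) dP(ω₂)`. -/
noncomputable def Phi {Ω : Type*} [MeasurableSpace Ω] (P : Measure Ω) (f g : Ω → ℝ) : ℝ :=
  ∫ ω₁, ∫ ω₂, Real.exp (-(f ω₁ - g ω₂) ^ 2) ∂P ∂P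

/-- The squared maximum mean discrepancy `Ψ(P; f, g)`. -/
noncomputable def Psi {Ω : Type*} [MeasurableSpace Ω] (P : Measure Ω) (f g : Ω → ℝ) : ℝ :=
  Phi P f f - 2 * Phi P f g + Phi P g g


open ProbabilityTheory

noncomputable def mmC {Ω : Type*} [MeasurableSpace Ω] (P : Measure Ω) (f : Ω → ℝ) (t : ℝ) : ℝ :=
  ∫ ω, Real.cos (t * f ω) ∂P

noncomputable def mmS {Ω : Type*} [MeasurableSpace Ω] (P : Measure Ω) (f : Ω → ℝ) (t : ℝ) : ℝ :=
  ∫ ω, Real.sin (t * f ω) ∂P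

lemma mm_kernel (x y : ℝ) : Real.exp (-(x - y) ^ 2) =
    ∫ t, (Real.cos (t * x) * Real.cos (t * y) + Real.sin (t * x) * Real.sin (t * y))
      ∂(gaussianReal 0 2) := by
  have h := charFun_gaussianReal (μ := 0) (v := 2) (x - y)
  rw [charFun_apply_real] at h
  have h2 := congrArg Complex.re h
  have hi : Integrable (fun t : ℝ => Complex.exp (((x - y : ℝ) : ℂ) * t * Complex.I))
      (gaussianReal 0 2) := by
    refine Integrable.of_bound (by fun_prop) 1 (Filter.Eventually.of_forall fun t => ?_)
    rw [← Complex.ofReal_mul, Complex.norm_exp_ofReal_mul_I]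
  have e1 : (∫ t : ℝ, Complex.exp (((x - y : ℝ) : ℂ) * t * Complex.I) ∂(gaussianReal 0 2)).re
      = ∫ t : ℝ, (Complex.exp (((x - y : ℝ) : ℂ) * t * Complex.I)).re ∂(gaussianReal 0 2) :=
    (integral_re hi).symm
  rw [e1] at h2
  have e2 : (Complex.exp (((x - y : ℝ) : ℂ) * ((0 : ℝ) : ℂ) * Complex.I
      - ((2 : NNReal) : ℂ) * ((x - y : ℝ) : ℂ) ^ 2 / 2)).re = Real.exp (-(x - y) ^ 2) := by
    rw [← Complex.exp_ofReal_re]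
    congr 2
    push_cast
    simp
  rw [e2] at h2
  rw [← h2]
  congr 1
  ext t
  rw [← Complex.ofReal_mul, Complex.exp_ofReal_mul_I_re, ← Real.cos_sub]
  congr 1
  ring

section
variable {Ω : Type*} [MeasurableSpace Ω] (P : Measure Ω) [IsProbabilityMeasure P]

lemma mm_intc (f : Ω → ℝ) (hf : Measurable f) (t : ℝ) :
    Integrable (fun ω => Real.cos (t * f ω)) P :=
  Integrable.of_bound (by fun_prop) 1 (Filter.Eventually.of_forall fun ω => Real.abs_cos_le_one _)

lemma mm_ints (f : Ω → ℝ) (hf : Measurable f) (t : ℝ) :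
    Integrable (fun ω => Real.sin (t * f ω)) P :=
  Integrable.of_bound (by fun_prop) 1 (Filter.Eventually.of_forall fun ω => Real.abs_sin_le_one _)

lemma mmC_cont (f : Ω → ℝ) (hf : Measurable f) : Continuous (mmC P f) := by
  unfold mmC
  refine continuous_of_dominated (bound := fun _ => 1) (fun t => (mm_intc P f hf t).1)
    (fun t => Filter.Eventually.of_forall fun ω => Real.abs_cos_le_one _)
    (integrable_const _) (Filter.Eventually.of_forall fun ω => by fun_prop)

lemma mmS_cont (f : Ω → ℝ) (hf : Measurable f) : Continuous (mmS P f) := by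
  unfold mmS
  refine continuous_of_dominated (bound := fun _ => 1) (fun t => (mm_ints P f hf t).1)
    (fun t => Filter.Eventually.of_forall fun ω => Real.abs_sin_le_one _)
    (integrable_const _) (Filter.Eventually.of_forall fun ω => by fun_prop)

lemma mmC_le (f : Ω → ℝ) (t : ℝ) : |mmC P f t| ≤ 1 := by
  have := norm_integral_le_of_norm_le_const (μ := P) (f := fun ω => Real.cos (t * f ω)) (C := 1)
    (Filter.Eventually.of_forall fun ω => Real.abs_cos_le_one _)
  simpa [mmC] using this

lemma mmS_le (f : Ω → ℝ) (t : ℝ) : |mmS P f t| ≤ 1 := by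
  have := norm_integral_le_of_norm_le_const (μ := P) (f := fun ω => Real.sin (t * f ω)) (C := 1)
    (Filter.Eventually.of_forall fun ω => Real.abs_sin_le_one _)
  simpa [mmS] using this

lemma mm_bound {a b c d : ℝ} (ha : |a| ≤ 1) (hb : |b| ≤ 1) (hc : |c| ≤ 1) (hd : |d| ≤ 1) :
    ‖a * b + c * d‖ ≤ 2 := by
  rw [Real.norm_eq_abs]
  have h1 : |a * b| ≤ 1 := by rw [abs_mul]; exact mul_le_one₀ ha (abs_nonneg _) hb
  have h2 : |c * d| ≤ 1 := by rw [abs_mul]; exact mul_le_one₀ hc (abs_nonneg _) hd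
  linarith [abs_add_le (a * b) (c * d)]

lemma mm_phi (f g : Ω → ℝ) (hf : Measurable f) (hg : Measurable g) :
    Phi P f g = ∫ t, (mmC P f t * mmC P g t + mmS P f t * mmS P g t) ∂(gaussianReal 0 2) := by
  have hC := (mmC_cont P g hg).measurable
  have hS := (mmS_cont P g hg).measurable
  unfold Phi
  have s1 : ∀ x : ℝ, ∫ ω₂, Real.exp (-(x - g ω₂) ^ 2) ∂P =
      ∫ t, (Real.cos (t * x) * mmC P g t + Real.sin (t * x) * mmS P g t) ∂(gaussianReal 0 2) := by
    intro x
    simp_rw [mm_kernel]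
    rw [integral_integral_swap]
    · congr 1
      ext t
      rw [integral_add ((mm_intc P g hg t).const_mul _) ((mm_ints P g hg t).const_mul _),
        integral_const_mul, integral_const_mul]
      rfl
    · refine Integrable.of_bound (Measurable.aestronglyMeasurable ?_) 2
        (Filter.Eventually.of_forall fun p => ?_)
      · simp only [Function.uncurry_def]; fun_prop
      · exact mm_bound (Real.abs_cos_le_one _) (Real.abs_cos_le_one _)
          (Real.abs_sin_le_one _) (Real.abs_sin_le_one _)
  simp_rw [s1]
  rw [integral_integral_swap]
  · congr 1
    ext t
    rw [integral_add ((mm_intc P f hf t).mul_const _) ((mm_ints P f hf t).mul_const _),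
      integral_mul_const, integral_mul_const]
    rfl
  · refine Integrable.of_bound (Measurable.aestronglyMeasurable ?_) 2
      (Filter.Eventually.of_forall fun p => ?_)
    · simp only [Function.uncurry_def]; fun_prop
    · exact mm_bound (Real.abs_cos_le_one _) (mmC_le P g _)
        (Real.abs_sin_le_one _) (mmS_le P g _)

lemma mm_int (f g : Ω → ℝ) (hf : Measurable f) (hg : Measurable g) :
    Integrable (fun t => mmC P f t * mmC P g t + mmS P f t * mmS P g t) (gaussianReal 0 2) := by
  have h1 := mmC_cont P f hf
  have h2 := mmC_cont P g hg
  have h3 := mmS_cont P f hf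
  have h4 := mmS_cont P g hg
  exact Integrable.of_bound (Continuous.aestronglyMeasurable (by fun_prop)) 2
    (Filter.Eventually.of_forall fun t =>
      mm_bound (mmC_le P f t) (mmC_le P g t) (mmS_le P f t) (mmS_le P g t))

lemma mm_charFun (f : Ω → ℝ) (hf : Measurable f) (t : ℝ) :
    charFun (Measure.map f P) t = (mmC P f t : ℂ) + (mmS P f t : ℂ) * Complex.I := by
  rw [charFun_apply_real, integral_map hf.aemeasurable (by fun_prop)]
  have e : ∀ ω, Complex.exp ((t : ℂ) * (f ω : ℂ) * Complex.I) =
      ((Real.cos (t * f ω) : ℝ) : ℂ) + ((Real.sin (t * f ω) : ℝ) : ℂ) * Complex.I := by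
    intro ω
    rw [Complex.exp_mul_I]
    push_cast
    rfl
  simp_rw [e]
  rw [integral_add (mm_intc P f hf t).ofReal ((mm_ints P f hf t).ofReal.mul_const _),
    integral_mul_const]
  congr 1
  · exact integral_ofReal
  · congr 1
    exact integral_ofReal

end

/-- If `f` and `g` are bounded measurable and `Ψ(P; f, g) = 0`, then `f(O)` and `g(O)` are
equal in distribution under `P`. -/
theorem map_eq_of_psi_eq_zero {Ω : Type*} [MeasurableSpace Ω] (P : Measure Ω)
    [IsProbabilityMeasure P] (f g : Ω → ℝ) (hf : Measurable f) (hg : Measurable g)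
    (hfb : ∃ C : ℝ, ∀ ω, |f ω| ≤ C) (hgb : ∃ C : ℝ, ∀ ω, |g ω| ≤ C)
    (h : Psi P f g = 0) :
    Measure.map f P = Measure.map g P := by
  have h1 := mmC_cont P f hf
  have h2 := mmC_cont P g hg
  have h3 := mmS_cont P f hf
  have h4 := mmS_cont P g hg
  have i1 := mm_int P f f hf hf
  have i2 := (mm_int P f g hf hg).const_mul 2
  have i3 := mm_int P g g hg hg
  unfold Psi at h
  rw [mm_phi P f f hf hf, mm_phi P f g hf hg, mm_phi P g g hg hg, ← integral_const_mul,
    ← integral_sub i1 i2, ← integral_add (by exact i1.sub i2) i3] at h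
  have hfun : (fun t => (mmC P f t * mmC P f t + mmS P f t * mmS P f t) -
      2 * (mmC P f t * mmC P g t + mmS P f t * mmS P g t) +
      (mmC P g t * mmC P g t + mmS P g t * mmS P g t)) =
      fun t => (mmC P f t - mmC P g t) ^ 2 + (mmS P f t - mmS P g t) ^ 2 := by
    ext t; ring
  have i4 := (i1.sub i2).add i3
  replace i4 : Integrable (fun t => (mmC P f t * mmC P f t + mmS P f t * mmS P f t) -
      2 * (mmC P f t * mmC P g t + mmS P f t * mmS P g t) +
      (mmC P g t * mmC P g t + mmS P g t * mmS P g t)) (gaussianReal 0 2) := i4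
  replace h : ∫ t, ((mmC P f t * mmC P f t + mmS P f t * mmS P f t) -
      2 * (mmC P f t * mmC P g t + mmS P f t * mmS P g t) +
      (mmC P g t * mmC P g t + mmS P g t * mmS P g t)) ∂(gaussianReal 0 2) = 0 := h
  rw [hfun] at h i4
  rw [integral_eq_zero_iff_of_nonneg (fun t => by positivity) i4] at h
  have hv := (gaussianReal_absolutelyContinuous' 0 (v := 2) (by norm_num)).ae_eq h
  have hz := (Continuous.ae_eq_iff_eq volume (by fun_prop) continuous_zero).1 hv
  refine Measure.ext_of_charFun ?_
  ext t
  rw [mm_charFun P f hf, mm_charFun P g hg]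
  have ht : (mmC P f t - mmC P g t) ^ 2 + (mmS P f t - mmS P g t) ^ 2 = 0 := congrFun hz t
  have a1 : mmC P f t = mmC P g t := by
    nlinarith [sq_nonneg (mmC P f t - mmC P g t), sq_nonneg (mmS P f t - mmS P g t)]
  have a2 : mmS P f t = mmS P g t := by
    nlinarith [sq_nonneg (mmC P f t - mmC P g t), sq_nonneg (mmS P f t - mmS P g t)]
  rw [a1, a2]
end

section
/- Let R, S, Dᴿ, Dˢ : Ω → ℝ be bounded measurable functions. If Measure.map R P = Measure.map S P (the null hypothesis H₀ holds), then for every ω ∈ Ω one has D^{R,R}(ω) − 2·D^{R,S}(ω) + D^{S,S}(ω) = 0; that is, the first-order canonical gradient of the squared maximum mean discrepancy vanishes identically under the null hypothesis. -/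
open MeasureTheory Real

/-- The component `D^{T,U}` of the first-order canonical gradient of the squared MMD,
for the pair `(T, Dᵀ)` and `(U, Dᵁ)`. -/
noncomputable def gradTU {Ω : Type*} [MeasurableSpace Ω] (P : Measure Ω)
    (T U DT DU : Ω → ℝ) (ω : Ω) : ℝ :=
  -2 * Phi P T U
    + ∫ ω₁, (2 * (U ω₁ - T ω) * DT ω + 1) * Real.exp (-(T ω - U ω₁) ^ 2) ∂P
    + ∫ ω₁, (2 * (T ω₁ - U ω) * DU ω + 1) * Real.exp (-(T ω₁ - U ω) ^ 2) ∂P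

/-- Under the null hypothesis `H₀` (equality in distribution of `R(O)` and `S(O)`), the
first-order canonical gradient `D^{R,R} − 2 D^{R,S} + D^{S,S}` of the squared MMD vanishes
identically. -/
theorem grad_vanishes_under_null {Ω : Type*} [MeasurableSpace Ω] (P : Measure Ω)
    [IsProbabilityMeasure P] (R S DR DS : Ω → ℝ)
    (hR : Measurable R) (hS : Measurable S) (hDR : Measurable DR) (hDS : Measurable DS)
    (hRb : ∃ C : ℝ, ∀ ω, |R ω| ≤ C) (hSb : ∃ C : ℝ, ∀ ω, |S ω| ≤ C)
    (hDRb : ∃ C : ℝ, ∀ ω, |DR ω| ≤ C) (hDSb : ∃ C : ℝ, ∀ ω, |DS ω| ≤ C)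
    (hnull : Measure.map R P = Measure.map S P) :
    ∀ ω : Ω, gradTU P R R DR DR ω - 2 * gradTU P R S DR DS ω + gradTU P S S DS DS ω = 0 := by
  intro ω
  have key : ∀ g : ℝ → ℝ, Measurable g → ∫ x, g (R x) ∂P = ∫ x, g (S x) ∂P := by
    intro g hg
    rw [← integral_map hR.aemeasurable hg.aestronglyMeasurable, hnull,
      integral_map hS.aemeasurable hg.aestronglyMeasurable]
  have h1 : Phi P R R = Phi P R S := by
    unfold Phi
    congr 1
    funext x
    exact key (fun u => Real.exp (-(R x - u) ^ 2)) (by fun_prop)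
  have h2 : Phi P R S = Phi P S S := by
    unfold Phi
    refine key (fun u => ∫ y, Real.exp (-(u - S y) ^ 2) ∂P) ?_
    have hm : Measurable (fun p : ℝ × Ω => Real.exp (-(p.1 - S p.2) ^ 2)) := by fun_prop
    exact hm.stronglyMeasurable.integral_prod_right.measurable
  have e1 := key (fun u => (2 * (u - R ω) * DR ω + 1) * Real.exp (-(R ω - u) ^ 2)) (by fun_prop)
  have e2 := key (fun u => (2 * (u - S ω) * DS ω + 1) * Real.exp (-(u - S ω) ^ 2)) (by fun_prop)
  have sw : ∀ a b : ℝ, (a - b) ^ 2 = (b - a) ^ 2 := fun a b => by ring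
  have s1 : ∫ x, (2 * (R x - R ω) * DR ω + 1) * Real.exp (-(R x - R ω) ^ 2) ∂P
      = ∫ x, (2 * (R x - R ω) * DR ω + 1) * Real.exp (-(R ω - R x) ^ 2) ∂P := by
    congr 1
    funext x
    rw [sw (R x)]
  have s2 : ∫ x, (2 * (S x - S ω) * DS ω + 1) * Real.exp (-(S ω - S x) ^ 2) ∂P
      = ∫ x, (2 * (S x - S ω) * DS ω + 1) * Real.exp (-(S x - S ω) ^ 2) ∂P := by
    congr 1
    funext x
    rw [sw (S x)]
  unfold gradTU
  rw [s1, s2, h1, h2, e1, e2]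
  ring
end

section
/- Suppose R is 𝔪_R-measurable, S is 𝔪_S-measurable, E[Dᴿ | 𝔪_R] = 0 P-a.e., E[Dˢ | 𝔪_S] = 0 P-a.e., and Measure.map R P = Measure.map S P (the null hypothesis H₀). Then the kernel Γ is one-degenerate: for every ω ∈ Ω, ∫ Γ(ω, ω₂) dP(ω₂) = 0 and ∫ Γ(ω₁, ω) dP(ω₁) = 0. -/
open MeasureTheory Real

/-- The kernel `Γ^{T,U}` built from the pair `(T, Dᵀ)` and `(U, Dᵁ)`. -/
noncomputable def GammaTU {Ω : Type*} (T U DT DU : Ω → ℝ) (ω₁ ω₂ : Ω) : ℝ :=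
  (2 * (T ω₁ - U ω₂) * (DU ω₂ - DT ω₁) + 1
      - (4 * (T ω₁ - U ω₂) ^ 2 - 2) * DT ω₁ * DU ω₂) * Real.exp (-(T ω₁ - U ω₂) ^ 2)

/-- The kernel `Γ = Γ^{R,R} − Γ^{R,S} − Γ^{S,R} + Γ^{S,S}`. -/
noncomputable def Gamma {Ω : Type*} (R S DR DS : Ω → ℝ) (ω₁ ω₂ : Ω) : ℝ :=
  GammaTU R R DR DR ω₁ ω₂ - GammaTU R S DR DS ω₁ ω₂
    - GammaTU S R DS DR ω₁ ω₂ + GammaTU S S DS DS ω₁ ω₂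

lemma bdd_comp_aux {Ω : Type*} (U : Ω → ℝ) (hUb : ∃ C : ℝ, ∀ ω, |U ω| ≤ C) (a : ℝ → ℝ)
    (ha : Continuous a) : ∃ K : ℝ, ∀ ω, ‖a (U ω)‖ ≤ K := by
  obtain ⟨C, hC⟩ := hUb
  obtain ⟨K, hK⟩ := (isCompact_Icc (a := -C) (b := C)).exists_bound_of_continuousOn
    ha.continuousOn
  exact ⟨K, fun ω => hK _ (abs_le.mp (hC ω))⟩

lemma gamma_aux {Ω : Type*} [F : MeasurableSpace Ω] (P : Measure Ω)
    [IsProbabilityMeasure P] (m : MeasurableSpace Ω) (hm : m ≤ F) (U DU : Ω → ℝ)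
    (hU : Measurable[m] U) (hD : Measurable[F] DU)
    (hUb : ∃ C : ℝ, ∀ ω, |U ω| ≤ C) (hDb : ∃ C : ℝ, ∀ ω, |DU ω| ≤ C)
    (hcond : P[DU|m] =ᵐ[P] 0) (T DT : Ω → ℝ) (ω : Ω) :
    Integrable (fun x => GammaTU T U DT DU ω x) P ∧
    ∫ x, GammaTU T U DT DU ω x ∂P =
      ∫ u, (1 - 2 * (T ω - u) * DT ω) * Real.exp (-(T ω - u) ^ 2) ∂(@Measure.map Ω ℝ F _ U P) := by
  have hUF : Measurable[F] U := hU.mono hm le_rfl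
  set a : ℝ → ℝ := fun u => (2 * (T ω - u) - (4 * (T ω - u) ^ 2 - 2) * DT ω) *
    Real.exp (-(T ω - u) ^ 2) with ha
  set b : ℝ → ℝ := fun u => (1 - 2 * (T ω - u) * DT ω) * Real.exp (-(T ω - u) ^ 2) with hb
  have hac : Continuous a := by fun_prop
  have hbc : Continuous b := by fun_prop
  obtain ⟨Ka, hKa⟩ := bdd_comp_aux U hUb a hac
  obtain ⟨Kb, hKb⟩ := bdd_comp_aux U hUb b hbc
  obtain ⟨KD, hKD⟩ := hDb
  have hDi : Integrable DU P :=
    Integrable.of_bound hD.aestronglyMeasurable KD (Filter.Eventually.of_forall hKD)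
  have hbi : Integrable (fun x => b (U x)) P :=
    Integrable.of_bound (hbc.measurable.comp hUF).aestronglyMeasurable Kb
      (Filter.Eventually.of_forall hKb)
  have hai : Integrable (fun x => a (U x) * DU x) P :=
    hDi.bdd_mul (c := Ka) (hac.measurable.comp hUF).aestronglyMeasurable
      (Filter.Eventually.of_forall hKa)
  have heq : (fun x => GammaTU T U DT DU ω x) = fun x => a (U x) * DU x + b (U x) := by
    funext x
    simp only [GammaTU, ha, hb]
    ring
  have hz : ∫ x, a (U x) * DU x ∂P = 0 := by
    have hsm : StronglyMeasurable[m] (fun x => a (U x)) :=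
      (hac.measurable.comp hU).stronglyMeasurable
    have h1 := condExp_mul_of_stronglyMeasurable_left (μ := P) (m := m) (g := DU) hsm hai hDi
    have h2 : ∫ x, (P[(fun x => a (U x)) * DU|m]) x ∂P = ∫ x, a (U x) * DU x ∂P :=
      integral_condExp hm
    rw [← h2]
    apply integral_eq_zero_of_ae
    filter_upwards [h1, hcond] with x hx hy
    rw [hx, Pi.mul_apply, hy]
    simp
  rw [heq]
  refine ⟨hai.add hbi, ?_⟩
  rw [integral_add hai hbi, hz, zero_add,
    integral_map hUF.aemeasurable hbc.measurable.aestronglyMeasurable]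

lemma GammaTU_symm_aux {Ω : Type*} (T U DT DU : Ω → ℝ) (x y : Ω) :
    GammaTU T U DT DU x y = GammaTU U T DU DT y x := by
  simp only [GammaTU]
  rw [show (U y - T x) ^ 2 = (T x - U y) ^ 2 by ring]
  ring

/-- Under the null hypothesis, the second-order gradient kernel `Γ` is one-degenerate. -/
theorem gamma_one_degenerate {Ω : Type*} [F : MeasurableSpace Ω] (P : Measure Ω)
    [IsProbabilityMeasure P]
    (mR mS : MeasurableSpace Ω) (hmR : mR ≤ F) (hmS : mS ≤ F)
    (R S DR DS : Ω → ℝ)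
    (hRm : Measurable[mR] R) (hSm : Measurable[mS] S)
    (hDRm : Measurable[F] DR) (hDSm : Measurable[F] DS)
    (hRb : ∃ C : ℝ, ∀ ω, |R ω| ≤ C) (hSb : ∃ C : ℝ, ∀ ω, |S ω| ≤ C)
    (hDRb : ∃ C : ℝ, ∀ ω, |DR ω| ≤ C) (hDSb : ∃ C : ℝ, ∀ ω, |DS ω| ≤ C)
    (hDRcond : P[DR|mR] =ᵐ[P] 0) (hDScond : P[DS|mS] =ᵐ[P] 0)
    (hnull : @Measure.map Ω ℝ F _ R P = @Measure.map Ω ℝ F _ S P) :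
    ∀ ω : Ω, (∫ ω₂, Gamma R S DR DS ω ω₂ ∂P = 0) ∧
      (∫ ω₁, Gamma R S DR DS ω₁ ω ∂P = 0) := by
  have key : ∀ ω : Ω, ∫ ω₂, Gamma R S DR DS ω ω₂ ∂P = 0 := by
    intro ω
    obtain ⟨i1, e1⟩ := gamma_aux (F := F) P mR hmR R DR hRm hDRm hRb hDRb hDRcond R DR ω
    obtain ⟨i2, e2⟩ := gamma_aux (F := F) P mS hmS S DS hSm hDSm hSb hDSb hDScond R DR ω
    obtain ⟨i3, e3⟩ := gamma_aux (F := F) P mR hmR R DR hRm hDRm hRb hDRb hDRcond S DS ω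
    obtain ⟨i4, e4⟩ := gamma_aux (F := F) P mS hmS S DS hSm hDSm hSb hDSb hDScond S DS ω
    simp only [_root_.Gamma]
    have j2 : Integrable (fun x => GammaTU R R DR DR ω x - GammaTU R S DR DS ω x) P := i1.sub i2
    have j3 : Integrable (fun x => GammaTU R R DR DR ω x - GammaTU R S DR DS ω x
      - GammaTU S R DS DR ω x) P := j2.sub i3
    rw [integral_add j3 i4, integral_sub j2 i3, integral_sub i1 i2, e1, e2, e3, e4, hnull]
    ring
  intro ω
  refine ⟨key ω, ?_⟩
  rw [← key ω]
  congr 1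
  funext x
  simp only [_root_.Gamma]
  rw [GammaTU_symm_aux R R DR DR x ω, GammaTU_symm_aux R S DR DS x ω,
    GammaTU_symm_aux S R DS DR x ω, GammaTU_symm_aux S S DS DS x ω]
  ring
end

section
/- Suppose R is 𝔪_R-measurable, S is 𝔪_S-measurable, E[Dᴿ | 𝔪_R] = 0 P-a.e. and E[Dˢ | 𝔪_S] = 0 P-a.e. Then the squared maximum mean discrepancy equals the double integral of the second-order gradient kernel: ∫∫ Γ(ω₁, ω₂) dP(ω₁) dP(ω₂) = Ψ(P; R, S). -/
open MeasureTheory Real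

lemma aux_q (t : ℝ) : |2 * t * Real.exp (-t ^ 2)| ≤ 1 := by
  have h1 := Real.add_one_le_exp (t ^ 2)
  rw [abs_mul, abs_of_pos (Real.exp_pos _), Real.exp_neg, ← div_eq_mul_inv,
    div_le_one (Real.exp_pos _)]
  refine le_trans ?_ h1
  rw [abs_le]
  constructor <;> nlinarith [sq_nonneg (t - 1), sq_nonneg (t + 1)]

lemma aux_k (t : ℝ) : |(4 * t ^ 2 - 2) * Real.exp (-t ^ 2)| ≤ 4 := by
  have h1 := Real.add_one_le_exp (t ^ 2)
  rw [abs_mul, abs_of_pos (Real.exp_pos _), Real.exp_neg, ← div_eq_mul_inv,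
    div_le_iff₀ (Real.exp_pos _), abs_le]
  constructor <;> nlinarith [sq_nonneg t]

lemma aux_e (t : ℝ) : |Real.exp (-t ^ 2)| ≤ 1 := by
  rw [abs_of_pos (Real.exp_pos _), Real.exp_le_one_iff]
  nlinarith [sq_nonneg t]

lemma aux_int {α : Type*} [MeasurableSpace α] (P : Measure α) [IsProbabilityMeasure P]
    (f : α → ℝ) (hf : Measurable f) (C : ℝ) (h : ∀ x, |f x| ≤ C) : Integrable f P :=
  Integrable.of_bound hf.aestronglyMeasurable C (Filter.Eventually.of_forall h)

lemma aux_lin {α : Type*} [MeasurableSpace α] (P : Measure α)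
    (a b c d : α → ℝ) (ha : Integrable a P) (hb : Integrable b P) (hc : Integrable c P)
    (hd : Integrable d P) : ∫ x, a x - b x + c x - d x ∂P =
      ∫ x, a x ∂P - ∫ x, b x ∂P + ∫ x, c x ∂P - ∫ x, d x ∂P := by
  have h1 : Integrable (fun x => a x - b x) P := ha.sub hb
  have h2 : Integrable (fun x => a x - b x + c x) P := h1.add hc
  rw [integral_sub h2 hd, integral_add h1 hc, integral_sub ha hb]

lemma aux_fubini {Ω : Type*} [F : MeasurableSpace Ω] (P : Measure Ω) [IsProbabilityMeasure P]
    (a b c d : Ω → Ω → ℝ)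
    (ha : Integrable (fun p : Ω × Ω => a p.1 p.2) (P.prod P))
    (hb : Integrable (fun p : Ω × Ω => b p.1 p.2) (P.prod P))
    (hc : Integrable (fun p : Ω × Ω => c p.1 p.2) (P.prod P))
    (hd : Integrable (fun p : Ω × Ω => d p.1 p.2) (P.prod P)) :
    ∫ x, ∫ y, (a x y - b x y - c x y + d x y) ∂P ∂P =
      ∫ x, ∫ y, a x y ∂P ∂P - ∫ x, ∫ y, b x y ∂P ∂P
      - ∫ x, ∫ y, c x y ∂P ∂P + ∫ x, ∫ y, d x y ∂P ∂P := by
  have h1 : Integrable (fun p : Ω × Ω => a p.1 p.2 - b p.1 p.2) (P.prod P) := ha.sub hb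
  have h2 : Integrable (fun p : Ω × Ω => a p.1 p.2 - b p.1 p.2 - c p.1 p.2) (P.prod P) :=
    h1.sub hc
  have h3 : Integrable (fun p : Ω × Ω => a p.1 p.2 - b p.1 p.2 - c p.1 p.2 + d p.1 p.2)
    (P.prod P) := h2.add hd
  rw [← integral_prod _ h3, integral_add h2 hd, integral_sub h1 hc, integral_sub ha hb,
    integral_prod _ ha, integral_prod _ hb, integral_prod _ hc, integral_prod _ hd]

lemma aux_zero {Ω : Type*} {m F : MeasurableSpace Ω} (P : Measure[F] Ω)
    [IsProbabilityMeasure P] (hm : m ≤ F) (T D : Ω → ℝ) (hT : Measurable[m] T)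
    (hD : Measurable[F] D) (C : ℝ) (hDb : ∀ ω, |D ω| ≤ C)
    (hc : P[D|m] =ᵐ[P] 0) (φ : ℝ → ℝ) (hφ : Measurable φ) (K : ℝ) (hK : ∀ x, |φ x| ≤ K) :
    ∫ ω, φ (T ω) * D ω ∂P = 0 := by
  have hDi : Integrable D P := aux_int P D hD C hDb
  have hs : StronglyMeasurable[m] (fun ω => φ (T ω)) :=
    (hφ.comp hT).stronglyMeasurable
  have hprod : Integrable ((fun ω => φ (T ω)) * D) P :=
    hDi.bdd_mul (c := K) (hs.mono hm).aestronglyMeasurable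
      (Filter.Eventually.of_forall fun ω => hK _)
  have h := condExp_mul_of_stronglyMeasurable_left hs hprod hDi
  have h2 := integral_condExp (μ := P) (f := (fun ω => φ (T ω)) * D) hm
  have h3 : ∫ ω, (P[(fun ω => φ (T ω)) * D|m]) ω ∂P = 0 := by
    apply integral_eq_zero_of_ae
    filter_upwards [h, hc] with ω h1 h2
    rw [h1]; simp [h2]
  rw [h3] at h2
  exact h2.symm

lemma gammaTU_meas {Ω : Type*} [F : MeasurableSpace Ω] (T U DT DU : Ω → ℝ)
    (hT : Measurable T) (hU : Measurable U) (hDT : Measurable DT) (hDU : Measurable DU) :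
    Measurable (fun p : Ω × Ω => GammaTU T U DT DU p.1 p.2) := by
  unfold GammaTU; fun_prop

lemma gammaTU_bound {Ω : Type*} (T U DT DU : Ω → ℝ) (A B : ℝ)
    (hA : ∀ ω, |DT ω| ≤ A) (hB : ∀ ω, |DU ω| ≤ B) (x y : Ω) :
    |GammaTU T U DT DU x y| ≤ (B + A) + 1 + 4 * (A * B) := by
  have e : GammaTU T U DT DU x y =
      (2 * (T x - U y) * Real.exp (-(T x - U y) ^ 2)) * (DU y - DT x)
      + Real.exp (-(T x - U y) ^ 2)
      - ((4 * (T x - U y) ^ 2 - 2) * Real.exp (-(T x - U y) ^ 2)) * (DT x * DU y) := by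
    unfold GammaTU; ring
  have hA0 : 0 ≤ A := (abs_nonneg _).trans (hA x)
  rw [e]
  refine (abs_sub _ _).trans (add_le_add ((abs_add_le _ _).trans (add_le_add ?_ (aux_e _))) ?_)
  · rw [abs_mul, ← one_mul (B + A)]
    exact mul_le_mul (aux_q _) ((abs_sub _ _).trans (add_le_add (hB _) (hA _)))
      (abs_nonneg _) zero_le_one
  · rw [abs_mul]
    refine mul_le_mul (aux_k _) ?_ (abs_nonneg _) (by norm_num)
    rw [abs_mul]
    exact mul_le_mul (hA _) (hB _) (abs_nonneg _) hA0

lemma gammaTU_integrable {Ω : Type*} [F : MeasurableSpace Ω] (P : Measure Ω)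
    [IsProbabilityMeasure P] (T U DT DU : Ω → ℝ)
    (hT : Measurable T) (hU : Measurable U) (hDT : Measurable DT) (hDU : Measurable DU)
    (A B : ℝ) (hA : ∀ ω, |DT ω| ≤ A) (hB : ∀ ω, |DU ω| ≤ B) :
    Integrable (fun p : Ω × Ω => GammaTU T U DT DU p.1 p.2) (P.prod P) :=
  aux_int _ _ (gammaTU_meas T U DT DU hT hU hDT hDU) _
    (fun p => gammaTU_bound T U DT DU A B hA hB p.1 p.2)

lemma gammaTU_eq {Ω : Type*} {mT mU F : MeasurableSpace Ω} (P : Measure[F] Ω)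
    [IsProbabilityMeasure P] (hmT : mT ≤ F) (hmU : mU ≤ F) (T U DT DU : Ω → ℝ)
    (hT : Measurable[mT] T) (hU : Measurable[mU] U)
    (hDT : Measurable[F] DT) (hDU : Measurable[F] DU)
    (A B : ℝ) (hA : ∀ ω, |DT ω| ≤ A) (hB : ∀ ω, |DU ω| ≤ B)
    (hcT : P[DT|mT] =ᵐ[P] 0) (hcU : P[DU|mU] =ᵐ[P] 0) :
    ∫ x, ∫ y, GammaTU T U DT DU x y ∂P ∂P = @Phi Ω F P T U := by
  have hT' : Measurable[F] T := hT.mono hmT le_rfl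
  have hU' : Measurable[F] U := hU.mono hmU le_rfl
  let φ : ℝ → ℝ := fun s => ∫ y, 2 * (s - U y) * Real.exp (-(s - U y) ^ 2) ∂P
  let ψ : ℝ → ℝ := fun s => ∫ y, Real.exp (-(s - U y) ^ 2) ∂P
  have hφm : Measurable φ := by
    have : Measurable[inferInstanceAs (MeasurableSpace (ℝ × ℝ))]
      (fun p : ℝ × ℝ => 2 * (p.1 - p.2) * Real.exp (-(p.1 - p.2) ^ 2)) := by fun_prop
    have h2 := @StronglyMeasurable.integral_prod_right ℝ Ω ℝ _ F P _ _ _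
      (fun s y => 2 * (s - U y) * Real.exp (-(s - U y) ^ 2))
      (this.comp (measurable_fst.prodMk (hU'.comp measurable_snd))).stronglyMeasurable
    exact h2.measurable
  have hψm : Measurable ψ := by
    have : Measurable[inferInstanceAs (MeasurableSpace (ℝ × ℝ))]
      (fun p : ℝ × ℝ => Real.exp (-(p.1 - p.2) ^ 2)) := by fun_prop
    have h2 := @StronglyMeasurable.integral_prod_right ℝ Ω ℝ _ F P _ _ _
      (fun s y => Real.exp (-(s - U y) ^ 2))
      (this.comp (measurable_fst.prodMk (hU'.comp measurable_snd))).stronglyMeasurable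
    exact h2.measurable
  have hφb : ∀ s, |φ s| ≤ 1 := fun s => by
    have := norm_integral_le_of_norm_le_const (μ := P)
      (f := fun y => 2 * (s - U y) * Real.exp (-(s - U y) ^ 2)) (C := 1)
      (Filter.Eventually.of_forall fun y => aux_q _)
    simpa using this
  have hψb : ∀ s, |ψ s| ≤ 1 := fun s => by
    have := norm_integral_le_of_norm_le_const (μ := P)
      (f := fun y => Real.exp (-(s - U y) ^ 2)) (C := 1)
      (Filter.Eventually.of_forall fun y => aux_e _)
    simpa using this
  have inner : ∀ x, ∫ y, GammaTU T U DT DU x y ∂P = ψ (T x) - φ (T x) * DT x := by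
    intro x
    have z1 := aux_zero P hmU U DU hU hDU B hB hcU
      (fun u => 2 * (T x - u) * Real.exp (-(T x - u) ^ 2)) (by fun_prop) 1 (fun u => aux_q _)
    have z2 := aux_zero P hmU U DU hU hDU B hB hcU
      (fun u => (4 * (T x - u) ^ 2 - 2) * Real.exp (-(T x - u) ^ 2)) (by fun_prop) 4
      (fun u => aux_k _)
    have iD : Integrable DU P := aux_int P DU hDU B hB
    have me : Measurable (fun u : ℝ => Real.exp (-(T x - u) ^ 2)) := by fun_prop
    have mq : Measurable (fun u : ℝ => 2 * (T x - u) * Real.exp (-(T x - u) ^ 2)) := by fun_prop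
    have mk : Measurable (fun u : ℝ => (4 * (T x - u) ^ 2 - 2) * Real.exp (-(T x - u) ^ 2)) := by
      fun_prop
    have ie : Integrable (fun y => Real.exp (-(T x - U y) ^ 2)) P :=
      aux_int P _ (me.comp hU') 1 (fun u => aux_e _)
    have iq : Integrable (fun y => 2 * (T x - U y) * Real.exp (-(T x - U y) ^ 2)) P :=
      aux_int P _ (mq.comp hU') 1 (fun u => aux_q _)
    have iqD : Integrable (fun y => 2 * (T x - U y) * Real.exp (-(T x - U y) ^ 2) * DU y) P :=
      iD.bdd_mul (c := 1) (mq.comp hU').aestronglyMeasurable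
        (Filter.Eventually.of_forall fun y => aux_q _)
    have ikD : Integrable
        (fun y => (4 * (T x - U y) ^ 2 - 2) * Real.exp (-(T x - U y) ^ 2) * DU y) P :=
      iD.bdd_mul (c := 4) (mk.comp hU').aestronglyMeasurable
        (Filter.Eventually.of_forall fun y => aux_k _)
    have e : ∀ y, GammaTU T U DT DU x y =
        ((Real.exp (-(T x - U y) ^ 2)
        - (2 * (T x - U y) * Real.exp (-(T x - U y) ^ 2)) * DT x)
        + 2 * (T x - U y) * Real.exp (-(T x - U y) ^ 2) * DU y)
        - ((4 * (T x - U y) ^ 2 - 2) * Real.exp (-(T x - U y) ^ 2) * DU y) * DT x := by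
      intro y; unfold GammaTU; ring
    simp_rw [e]
    rw [aux_lin P _ _ _ _ ie (iq.mul_const (DT x)) iqD (ikD.mul_const (DT x)),
      integral_mul_const, integral_mul_const, z1, z2]
    simp [φ, ψ]
  simp_rw [inner]
  have iψ : Integrable (fun x => ψ (T x)) P := aux_int P _ (hψm.comp hT') 1 (fun x => hψb _)
  have iφ : Integrable (fun x => φ (T x) * DT x) P :=
    (aux_int P DT hDT A hA).bdd_mul (c := 1) (hφm.comp hT').aestronglyMeasurable
      (Filter.Eventually.of_forall fun y => hφb _)
  rw [integral_sub iψ iφ, aux_zero P hmT T DT hT hDT A hA hcT φ hφm 1 hφb, sub_zero]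
  rfl

lemma phi_symm {Ω : Type*} [F : MeasurableSpace Ω] (P : Measure Ω)
    [IsProbabilityMeasure P] (T U : Ω → ℝ)
    (hT : Measurable T) (hU : Measurable U) : Phi P T U = Phi P U T := by
  unfold Phi
  rw [integral_integral_swap]
  · congr 1; ext x; congr 1; ext y; congr 2; ring
  · exact aux_int _ _ (by unfold Function.uncurry; fun_prop) 1 (fun p => aux_e _)

/-- The squared MMD equals the double integral of the second-order gradient kernel:
`∫∫ Γ dP dP = Ψ(P; R, S)`. -/
theorem double_integral_gamma_eq_psi {Ω : Type*} [F : MeasurableSpace Ω] (P : Measure Ω)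
    [IsProbabilityMeasure P]
    (mR mS : MeasurableSpace Ω) (hmR : mR ≤ F) (hmS : mS ≤ F)
    (R S DR DS : Ω → ℝ)
    (hRm : Measurable[mR] R) (hSm : Measurable[mS] S)
    (hDRm : Measurable[F] DR) (hDSm : Measurable[F] DS)
    (hRb : ∃ C : ℝ, ∀ ω, |R ω| ≤ C) (hSb : ∃ C : ℝ, ∀ ω, |S ω| ≤ C)
    (hDRb : ∃ C : ℝ, ∀ ω, |DR ω| ≤ C) (hDSb : ∃ C : ℝ, ∀ ω, |DS ω| ≤ C)
    (hDRcond : P[DR|mR] =ᵐ[P] 0) (hDScond : P[DS|mS] =ᵐ[P] 0) :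
    ∫ ω₁, ∫ ω₂, Gamma R S DR DS ω₁ ω₂ ∂P ∂P = @Psi Ω F P R S := by
  obtain ⟨A, hA⟩ := hDRb
  obtain ⟨B, hB⟩ := hDSb
  have hR' : Measurable[F] R := hRm.mono hmR le_rfl
  have hS' : Measurable[F] S := hSm.mono hmS le_rfl
  have iRR := @gammaTU_integrable Ω F P _ R R DR DR hR' hR' hDRm hDRm A A hA hA
  have iRS := @gammaTU_integrable Ω F P _ R S DR DS hR' hS' hDRm hDSm A B hA hB
  have iSR := @gammaTU_integrable Ω F P _ S R DS DR hS' hR' hDSm hDRm B A hB hA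
  have iSS := @gammaTU_integrable Ω F P _ S S DS DS hS' hS' hDSm hDSm B B hB hB
  have eRR := gammaTU_eq P hmR hmR R R DR DR hRm hRm hDRm hDRm A A hA hA hDRcond hDRcond
  have eRS := gammaTU_eq P hmR hmS R S DR DS hRm hSm hDRm hDSm A B hA hB hDRcond hDScond
  have eSR := gammaTU_eq P hmS hmR S R DS DR hSm hRm hDSm hDRm B A hB hA hDScond hDRcond
  have eSS := gammaTU_eq P hmS hmS S S DS DS hSm hSm hDSm hDSm B B hB hB hDScond hDScond
  have hs := @phi_symm Ω F P _ S R hS' hR'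
  have key := @aux_fubini Ω F P _ (GammaTU R R DR DR) (GammaTU R S DR DS) (GammaTU S R DS DR)
    (GammaTU S S DS DS) iRR iRS iSR iSS
  rw [eRR, eRS, eSR, eSS, hs] at key
  refine Eq.trans key ?_
  unfold Psi
  ring
end

section
/- Let (Ω, 𝔉, P) be a probability space, 𝒢 ⊆ 𝔉 a sub-σ-algebra, and X : Ω → ℝ square-integrable. If X and its conditional expectation E[X | 𝒢] are equal in distribution, i.e. Measure.map X P = Measure.map (E[X | 𝒢]) P, then X = E[X | 𝒢] P-a.e. -/
open MeasureTheory

theorem aux_eq_condexp {Ω : Type*} {G F : MeasurableSpace Ω} (P : Measure Ω)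
    [IsProbabilityMeasure P] (hG : G ≤ F)
    (X : Ω → ℝ) (hX : MemLp X 2 P)
    (hmap : Measure.map X P = Measure.map (P[X|G]) P) :
    X =ᵐ[P] P[X|G] := by
  have hY : MemLp (P[X|G]) 2 P := hX.condExp (by norm_num)
  have hid : ProbabilityTheory.IdentDistrib X (P[X|G]) P P :=
    ⟨hX.aestronglyMeasurable.aemeasurable, hY.aestronglyMeasurable.aemeasurable, hmap⟩
  have hv := hid.variance_eq
  have ht := ProbabilityTheory.integral_condVar_add_variance_condExp hG hX
  have h0 : ∫ ω, (ProbabilityTheory.condVar G X P) ω ∂P = 0 := by linarith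
  have hint : Integrable (fun ω => (X ω - (P[X|G]) ω) ^ 2) P := (hX.sub hY).integrable_sq
  have h1 : ∫ ω, (X ω - (P[X|G]) ω) ^ 2 ∂P = 0 := by
    rw [← h0]
    exact (integral_condExp hG).symm
  rw [integral_eq_zero_iff_of_nonneg (fun ω => sq_nonneg _) hint] at h1
  filter_upwards [h1] with ω hω
  exact sub_eq_zero.mp (pow_eq_zero_iff (two_ne_zero) |>.mp hω)

/-- If a square-integrable random variable and its conditional expectation are equal in
distribution, then they are almost surely equal. -/
theorem eq_condexp_of_map_eq {Ω : Type*} [F : MeasurableSpace Ω] (P : Measure Ω)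
    [IsProbabilityMeasure P] (G : MeasurableSpace Ω) (hG : G ≤ F)
    (X : Ω → ℝ) (hX : MemLp X 2 P)
    (hmap : @Measure.map Ω ℝ F _ X P = @Measure.map Ω ℝ F _ (P[X|G]) P) :
    X =ᵐ[P] P[X|G] := by
  exact aux_eq_condexp P hG X hX hmap
end

section
/- Suppose R is 𝔪_R-measurable, S is 𝔪_S-measurable, E[Dᴿ | 𝔪_R] = 0 P-a.e., E[Dˢ | 𝔪_S] = 0 P-a.e., and Measure.map R P = Measure.map S P (the null hypothesis H₀). Then the kernel Γ is positive semidefinite on L²(P): for every h ∈ L²(P), ∫∫ Γ(ω₁, ω₂)·h(ω₁)·h(ω₂) dP(ω₁) dP(ω₂) ≥ 0. In particular, all eigenvalues of the integral operator h ↦ ∫ Γ(·, ω)·h(ω) dP(ω) on L²(P) are nonnegative. -/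
open MeasureTheory Real

lemma hs_cast {f g : ℕ → ℝ} {a b : ℝ} (h : HasSum f a) (hf : ∀ n, g n = f n) (hb : b = a) :
    HasSum g b := by
  obtain rfl : g = f := funext hf
  rw [hb]; exact h

/-- weight -/
noncomputable def gw (n : ℕ) : ℝ := 2 ^ n / (n.factorial : ℝ)

noncomputable def gp (n : ℕ) (x a : ℝ) : ℝ :=
  x ^ n + a * (n * x ^ (n - 1) - 2 * x ^ (n + 1))

lemma gw_nonneg (n : ℕ) : 0 ≤ gw n := by unfold gw; positivity

lemma gw_succ (n : ℕ) : gw (n + 1) * ((n : ℝ) + 1) = 2 * gw n := by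
  unfold gw
  rw [Nat.factorial_succ]
  have : (n.factorial : ℝ) ≠ 0 := by positivity
  have : (n : ℝ) + 1 ≠ 0 := by positivity
  push_cast
  field_simp
  ring

lemma hs_A (x y : ℝ) : HasSum (fun n => gw n * (x ^ n * y ^ n)) (Real.exp (2 * x * y)) := by
  have h := NormedSpace.expSeries_div_hasSum_exp (2 * x * y : ℝ)
  rw [← Real.exp_eq_exp_ℝ] at h
  refine hs_cast h (fun n => ?_) rfl
  unfold gw
  rw [mul_pow, mul_pow]; ring

lemma hs_B (x y : ℝ) : HasSum (fun n : ℕ => gw n * (n * x ^ (n - 1) * y ^ n))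
    (2 * y * Real.exp (2 * x * y)) := by
  rw [← hasSum_nat_add_iff' 1]
  refine hs_cast ((hs_A x y).mul_left (2 * y)) (fun n => ?_) ?_
  · have := gw_succ n
    simp only [Nat.add_sub_cancel, Nat.cast_add, Nat.cast_one, pow_succ]
    linear_combination (x ^ n * y ^ n * y) * this
  · simp

lemma hs_C (x y : ℝ) : HasSum (fun n : ℕ => gw n * (n ^ 2 * x ^ (n - 1) * y ^ (n - 1)))
    ((2 + 4 * x * y) * Real.exp (2 * x * y)) := by
  rw [← hasSum_nat_add_iff' 1]
  refine hs_cast (((hs_A x y).mul_left 2).add ((hs_B x y).mul_left (2 * x))) (fun n => ?_) ?_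
  · have := gw_succ n
    have e : (n : ℝ) * x ^ (n - 1) * x = n * x ^ n := by
      cases n <;> simp [pow_succ, mul_assoc]
    simp only [Nat.add_sub_cancel, Nat.cast_add, Nat.cast_one]
    linear_combination (x ^ n * y ^ n * (n + 1)) * this - 2 * gw n * y ^ n * e
  · simp; ring

lemma hs_pair (x y a b : ℝ) : HasSum (fun n : ℕ => gw n *
    ((gp n x a * Real.exp (-x ^ 2)) * (gp n y b * Real.exp (-y ^ 2))))
    ((2 * (x - y) * (b - a) + 1 - (4 * (x - y) ^ 2 - 2) * a * b) * Real.exp (-(x - y) ^ 2)) := by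
  have hA := hs_A x y
  have hB := hs_B x y
  have hB' := hs_B y x
  have hC := hs_C x y
  have e1 : Real.exp (-(x - y) ^ 2)
      = Real.exp (2 * x * y) * (Real.exp (-x ^ 2) * Real.exp (-y ^ 2)) := by
    rw [← Real.exp_add, ← Real.exp_add]; congr 1; ring
  have e2 : 2 * y * x = 2 * x * y := by ring
  rw [e2] at hB'
  have := ((((hA.mul_left (1 - 2 * b * y - 2 * a * x + 4 * a * b * x * y)).add
    (hB.mul_left (a - 2 * a * b * y))).add
    (hB'.mul_left (b - 2 * a * b * x))).add
    (hC.mul_left (a * b))).mul_right (Real.exp (-x ^ 2) * Real.exp (-y ^ 2))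
  refine hs_cast this (fun n => ?_) ?_
  · unfold gp
    rw [pow_succ x n, pow_succ y n]
    ring
  · rw [e1]; ring

lemma psd_of_hasSum {Ω : Type*} [MeasurableSpace Ω] (P : Measure Ω)
    (K : Ω → Ω → ℝ) (w : ℕ → ℝ) (hw : ∀ n, 0 ≤ w n) (g : ℕ → Ω → ℝ) (C : ℕ → ℝ)
    (hg : ∀ n, Measurable (g n)) (hC : ∀ n ω, |g n ω| ≤ C n) (hC0 : ∀ n, 0 ≤ C n)
    (hs : Summable fun n => w n * C n ^ 2)
    (hK : ∀ x y, HasSum (fun n => w n * (g n x * g n y)) (K x y))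
    (h : Ω → ℝ) (hh : Integrable h P) :
    0 ≤ ∫ ω₁, ∫ ω₂, K ω₁ ω₂ * h ω₁ * h ω₂ ∂P ∂P := by
  have hgi : ∀ n, Integrable (fun ω => g n ω * h ω) P := fun n =>
    hh.bdd_mul (c := C n) (hg n).aestronglyMeasurable (Filter.Eventually.of_forall (hC n))
  have hb : ∀ n, ∫ ω, ‖g n ω * h ω‖ ∂P ≤ C n * ∫ ω, ‖h ω‖ ∂P := by
    intro n
    rw [← integral_const_mul]
    refine integral_mono (hgi n).norm (hh.norm.const_mul _) fun ω => ?_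
    simp only [norm_mul]
    exact mul_le_mul_of_nonneg_right (hC n ω) (norm_nonneg _)
  have hb0 : ∀ n, 0 ≤ ∫ ω, ‖g n ω * h ω‖ ∂P := fun n => integral_nonneg fun _ => norm_nonneg _
  have hI0 : 0 ≤ ∫ ω, ‖h ω‖ ∂P := integral_nonneg fun _ => norm_nonneg _
  have inner : ∀ x, HasSum (fun n => w n * (g n x * h x) * ∫ y, g n y * h y ∂P)
      (∫ y, K x y * h x * h y ∂P) := by
    intro x
    have key := hasSum_integral_of_summable_integral_norm (E := ℝ) (μ := P)
      (F := fun n y => w n * (g n x * h x) * (g n y * h y)) (fun n => (hgi n).const_mul _) ?_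
    · simp only [integral_const_mul] at key
      refine hs_cast key (fun n => rfl) ?_
      refine integral_congr_ae (μ := P) (G := ℝ) (Filter.Eventually.of_forall fun y => ?_)
      have := ((hK x y).mul_right (h x * h y)).tsum_eq
      simp only
      rw [mul_assoc, ← this]
      exact tsum_congr fun n => by ring
    · refine Summable.of_nonneg_of_le (fun n => integral_nonneg fun _ => norm_nonneg _) (fun n => ?_)
        (hs.mul_right (|h x| * ∫ ω, ‖h ω‖ ∂P))
      simp only [norm_mul (w n * (g n x * h x)), integral_const_mul]
      calc ‖w n * (g n x * h x)‖ * ∫ ω, ‖g n ω * h ω‖ ∂P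
          ≤ (w n * (C n * |h x|)) * (C n * ∫ ω, ‖h ω‖ ∂P) := by
            refine mul_le_mul ?_ (hb n) (hb0 n) (mul_nonneg (hw n) (mul_nonneg (hC0 n) (abs_nonneg _)))
            rw [norm_mul, norm_mul, Real.norm_of_nonneg (hw n)]
            exact mul_le_mul_of_nonneg_left
              (mul_le_mul_of_nonneg_right (hC n x) (abs_nonneg _)) (hw n)
        _ = _ := by ring
  have key := hasSum_integral_of_summable_integral_norm (E := ℝ) (μ := P)
      (F := fun n x => w n * (∫ y, g n y * h y ∂P) * (g n x * h x))
      (fun n => (hgi n).const_mul _) ?_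
  · have e : ∫ ω₁, ∫ ω₂, K ω₁ ω₂ * h ω₁ * h ω₂ ∂P ∂P
        = ∫ x, ∑' n, w n * (∫ y, g n y * h y ∂P) * (g n x * h x) ∂P := by
      refine integral_congr_ae (Filter.Eventually.of_forall fun x => ?_)
      simp only
      rw [← (inner x).tsum_eq]
      exact tsum_congr fun n => by ring
    rw [e]
    refine key.nonneg fun n => ?_
    rw [integral_const_mul, mul_assoc]
    exact mul_nonneg (hw n) (mul_self_nonneg _)
  · refine Summable.of_nonneg_of_le (fun n => integral_nonneg fun _ => norm_nonneg _) (fun n => ?_)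
        (hs.mul_right ((∫ ω, ‖h ω‖ ∂P) * ∫ ω, ‖h ω‖ ∂P))
    simp only [norm_mul (w n * _), integral_const_mul]
    calc ‖w n * ∫ y, g n y * h y ∂P‖ * ∫ ω, ‖g n ω * h ω‖ ∂P
          ≤ (w n * (C n * ∫ ω, ‖h ω‖ ∂P)) * (C n * ∫ ω, ‖h ω‖ ∂P) := by
            refine mul_le_mul ?_ (hb n) (hb0 n) (mul_nonneg (hw n) (mul_nonneg (hC0 n) hI0))
            rw [norm_mul, Real.norm_of_nonneg (hw n)]
            exact mul_le_mul_of_nonneg_left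
              ((norm_integral_le_integral_norm _).trans (hb n)) (hw n)
        _ = _ := by ring

lemma gp_bound (n : ℕ) (x a M : ℝ) (hM : 1 ≤ M) (hx : |x| ≤ M) (ha : |a| ≤ M) :
    |gp n x a * Real.exp (-x ^ 2)| ≤ 3 * M ^ 2 * (2 * M) ^ n := by
  have hM0 : 0 ≤ M := by linarith
  have h1 : |x| ^ n ≤ M ^ n := pow_le_pow_left₀ (abs_nonneg _) hx n
  have h2 : |x| ^ (n - 1) ≤ M ^ n :=
    (pow_le_pow_left₀ (abs_nonneg _) hx _).trans (pow_le_pow_right₀ hM (Nat.sub_le _ _))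
  have h3 : |x| ^ (n + 1) ≤ M ^ (n + 1) := pow_le_pow_left₀ (abs_nonneg _) hx _
  have hexp : Real.exp (-x ^ 2) ≤ 1 := Real.exp_le_one_iff.2 (by nlinarith [sq_nonneg x])
  have hn : (n : ℝ) + 1 ≤ 2 ^ n := by exact_mod_cast Nat.lt_two_pow_self
  have h4 : |(n : ℝ) * x ^ (n - 1) - 2 * x ^ (n + 1)| ≤ n * M ^ n + 2 * M ^ (n + 1) := by
    refine (abs_sub _ _).trans ?_
    rw [abs_mul, abs_mul, abs_pow, abs_pow, Nat.abs_cast, abs_two]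
    gcongr
  have h5 : |gp n x a| ≤ M ^ n + M * (n * M ^ n + 2 * M ^ (n + 1)) := by
    unfold gp
    refine (abs_add_le _ _).trans ?_
    rw [abs_mul, abs_pow]
    gcongr
  rw [abs_mul, Real.abs_exp]
  calc |gp n x a| * Real.exp (-x ^ 2) ≤ |gp n x a| * 1 := by gcongr
    _ ≤ M ^ n + M * (n * M ^ n + 2 * M ^ (n + 1)) := by rw [mul_one]; exact h5
    _ = M ^ n * (1 + n * M + 2 * M ^ 2) := by ring
    _ ≤ M ^ n * (3 * M ^ 2 * 2 ^ n) := by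
        gcongr
        have hMM : M ≤ M ^ 2 := by nlinarith
        have h0 : (0 : ℝ) ≤ n := Nat.cast_nonneg n
        have : (n : ℝ) * M ≤ n * M ^ 2 := by gcongr
        have : M ^ 2 * ((n : ℝ) + 1) ≤ M ^ 2 * 2 ^ n := by gcongr
        nlinarith [sq_nonneg M, mul_nonneg h0 (sq_nonneg M)]
    _ = _ := by rw [mul_pow]; ring


lemma gamma_aux_s17 {Ω : Type*} [F : MeasurableSpace Ω] (P : Measure Ω)
    [IsProbabilityMeasure P] (R S DR DS : Ω → ℝ)
    (hR : Measurable R) (hS : Measurable S) (hDRm : Measurable DR) (hDSm : Measurable DS)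
    (hRb : ∃ C : ℝ, ∀ ω, |R ω| ≤ C) (hSb : ∃ C : ℝ, ∀ ω, |S ω| ≤ C)
    (hDRb : ∃ C : ℝ, ∀ ω, |DR ω| ≤ C) (hDSb : ∃ C : ℝ, ∀ ω, |DS ω| ≤ C)
    (h : Ω → ℝ) (hh : MemLp h 2 P) :
      0 ≤ ∫ ω₁, ∫ ω₂, Gamma R S DR DS ω₁ ω₂ * h ω₁ * h ω₂ ∂P ∂P := by
  obtain ⟨C1, h1⟩ := hRb
  obtain ⟨C2, h2⟩ := hSb
  obtain ⟨C3, h3⟩ := hDRb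
  obtain ⟨C4, h4⟩ := hDSb
  obtain ⟨M, hM, hM1, hM2, hM3, hM4⟩ : ∃ M : ℝ, 1 ≤ M ∧ C1 ≤ M ∧ C2 ≤ M ∧ C3 ≤ M ∧ C4 ≤ M :=
    ⟨max 1 (max C1 (max C2 (max C3 C4))), by simp, by simp, by simp, by simp, by simp⟩
  have hM0 : 0 ≤ M := by linarith
  refine psd_of_hasSum P _ gw gw_nonneg
    (fun n ω => gp n (R ω) (DR ω) * Real.exp (-(R ω) ^ 2)
      - gp n (S ω) (DS ω) * Real.exp (-(S ω) ^ 2))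
    (fun n => 6 * M ^ 2 * (2 * M) ^ n) ?_ ?_ ?_ ?_ ?_ h (hh.integrable (by norm_num))
  · intro n
    unfold gp
    fun_prop
  · intro n ω
    have b1 := gp_bound n (R ω) (DR ω) M hM ((h1 ω).trans hM1) ((h3 ω).trans hM3)
    have b2 := gp_bound n (S ω) (DS ω) M hM ((h2 ω).trans hM2) ((h4 ω).trans hM4)
    refine (abs_sub _ _).trans ?_
    linarith
  · intro n
    positivity
  · have := (Real.summable_pow_div_factorial (8 * M ^ 2)).mul_left (36 * M ^ 4)
    refine this.congr fun n => ?_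
    unfold gw
    have e : (8 * M ^ 2) ^ n = 2 ^ n * ((2 * M) ^ n) ^ 2 := by
      rw [← pow_mul, mul_comm n 2, pow_mul, ← mul_pow]; congr 1; ring
    rw [e]
    ring
  · intro x y
    have := (((hs_pair (R x) (R y) (DR x) (DR y)).sub (hs_pair (R x) (S y) (DR x) (DS y))).sub
      (hs_pair (S x) (R y) (DS x) (DR y))).add (hs_pair (S x) (S y) (DS x) (DS y))
    unfold _root_.Gamma GammaTU
    refine hs_cast this (fun n => ?_) rfl
    ring

/-- Under the null hypothesis, the second-order gradient kernel `Γ` is positive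
semidefinite on `L²(P)`. -/
theorem gamma_posSemidef_under_null {Ω : Type*} [F : MeasurableSpace Ω] (P : Measure Ω)
    [IsProbabilityMeasure P]
    (mR mS : MeasurableSpace Ω) (hmR : mR ≤ F) (hmS : mS ≤ F)
    (R S DR DS : Ω → ℝ)
    (hRm : Measurable[mR] R) (hSm : Measurable[mS] S)
    (hDRm : Measurable[F] DR) (hDSm : Measurable[F] DS)
    (hRb : ∃ C : ℝ, ∀ ω, |R ω| ≤ C) (hSb : ∃ C : ℝ, ∀ ω, |S ω| ≤ C)
    (hDRb : ∃ C : ℝ, ∀ ω, |DR ω| ≤ C) (hDSb : ∃ C : ℝ, ∀ ω, |DS ω| ≤ C)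
    (hDRcond : P[DR|mR] =ᵐ[P] 0) (hDScond : P[DS|mS] =ᵐ[P] 0)
    (hnull : @Measure.map Ω ℝ F _ R P = @Measure.map Ω ℝ F _ S P) :
    ∀ h : Ω → ℝ, Measurable[F] h → MemLp h 2 P →
      0 ≤ ∫ ω₁, ∫ ω₂, Gamma R S DR DS ω₁ ω₂ * h ω₁ * h ω₂ ∂P ∂P := by
  intro h hhm hh
  exact @gamma_aux_s17 Ω F P _ R S DR DS (hRm.mono hmR le_rfl) (hSm.mono hmS le_rfl) hDRm hDSm
    hRb hSb hDRb hDSb h hh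
end

section
/- For P-a.e. ω, the linearization remainder of the conditional average treatment effect equals the double-robust expression: (μ(1, W) − μ(0, W)) − (μ₀(1, W) − μ₀(0, W)) + E[D | 𝒢] = Σ_{a ∈ {0,1}} (2a − 1)·(1 − π₀(a, W)/π(a, W))·(μ(a, W) − μ₀(a, W)). In particular, this remainder vanishes whenever π(a, W) = π₀(a, W) a.e. (correct treatment mechanism) or μ(a, W) = μ₀(a, W) a.e. (correct outcome regression). -/
open MeasureTheory Real

/-- Double-robust representation of the linearization remainder of the conditional average
treatment effect, and its vanishing under a correctly specified treatment mechanism or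
outcome regression. -/
theorem cate_remainder_double_robust {Ω : Type*} [F : MeasurableSpace Ω] (P : Measure Ω)
    [IsProbabilityMeasure P] {𝒲 : Type*} [MeasurableSpace 𝒲]
    (W : Ω → 𝒲) (hW : Measurable W)
    (A : Ω → ℝ) (hA : Measurable A) (hA01 : ∀ ω, A ω = 0 ∨ A ω = 1)
    (Y : Ω → ℝ) (hYm : Measurable Y) (hYint : Integrable Y P) (hYb : ∃ c : ℝ, ∀ ω, |Y ω| ≤ c)
    -- the true outcome regression `μ₀(A, W) = E[Y | σ(W, A)]` a.e.
    (μ₀ : ℝ × 𝒲 → ℝ) (hμ₀m : Measurable μ₀)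
    (hμ₀ : (fun ω => μ₀ (A ω, W ω)) =ᵐ[P]
      P[Y | MeasurableSpace.comap (fun ω => (W ω, A ω)) inferInstance])
    -- the true treatment mechanism `p₀(W) = E[𝟙{A = 1} | σ(W)]` a.e.
    (p₀ : 𝒲 → ℝ) (hp₀m : Measurable p₀) (hp₀01 : ∀ w, p₀ w ∈ Set.Icc (0 : ℝ) 1)
    (hp₀ : (fun ω => p₀ (W ω)) =ᵐ[P]
      P[fun ω => if A ω = 1 then (1 : ℝ) else 0 | MeasurableSpace.comap W inferInstance])
    -- an arbitrary bounded outcome regression and a treatment mechanism bounded away from 0, 1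
    (μ : ℝ × 𝒲 → ℝ) (hμm : Measurable μ) (hμb : ∃ c : ℝ, ∀ x, |μ x| ≤ c)
    (p : 𝒲 → ℝ) (hpm : Measurable p) (δ : ℝ) (hδ : 0 < δ) (hp : ∀ w, δ ≤ p w ∧ p w ≤ 1 - δ) :
    (∀ᵐ ω ∂P,
        (μ (1, W ω) - μ (0, W ω)) - (μ₀ (1, W ω) - μ₀ (0, W ω))
          + (P[fun ω' => ((2 * A ω' - 1) / (if A ω' = 1 then p (W ω') else 1 - p (W ω')))
                * (Y ω' - μ (A ω', W ω')) | MeasurableSpace.comap W inferInstance]) ω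
        = (1 - p₀ (W ω) / p (W ω)) * (μ (1, W ω) - μ₀ (1, W ω))
          - (1 - (1 - p₀ (W ω)) / (1 - p (W ω))) * (μ (0, W ω) - μ₀ (0, W ω))) ∧
    (((fun ω => p (W ω)) =ᵐ[P] fun ω => p₀ (W ω)) →
      ∀ᵐ ω ∂P,
        (μ (1, W ω) - μ (0, W ω)) - (μ₀ (1, W ω) - μ₀ (0, W ω))
          + (P[fun ω' => ((2 * A ω' - 1) / (if A ω' = 1 then p (W ω') else 1 - p (W ω')))
                * (Y ω' - μ (A ω', W ω')) | MeasurableSpace.comap W inferInstance]) ω = 0) ∧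
    ((((fun ω => μ (1, W ω)) =ᵐ[P] fun ω => μ₀ (1, W ω)) ∧
        ((fun ω => μ (0, W ω)) =ᵐ[P] fun ω => μ₀ (0, W ω))) →
      ∀ᵐ ω ∂P,
        (μ (1, W ω) - μ (0, W ω)) - (μ₀ (1, W ω) - μ₀ (0, W ω))
          + (P[fun ω' => ((2 * A ω' - 1) / (if A ω' = 1 then p (W ω') else 1 - p (W ω')))
                * (Y ω' - μ (A ω', W ω')) | MeasurableSpace.comap W inferInstance]) ω = 0) := by
  obtain ⟨cμ, hcμ⟩ := hμb
  have hHle : MeasurableSpace.comap (fun ω => (W ω, A ω)) inferInstance ≤ F :=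
    (hW.prodMk hA).comap_le
  have hGle : MeasurableSpace.comap W inferInstance ≤ F := hW.comap_le
  have hGH : MeasurableSpace.comap W inferInstance ≤
      MeasurableSpace.comap (fun ω => (W ω, A ω)) inferInstance := by
    have h1 : Measurable[MeasurableSpace.comap (fun ω => (W ω, A ω)) inferInstance]
        (fun ω => (W ω, A ω)) := comap_measurable _
    exact (measurable_fst.comp h1).comap_le
  set H : MeasurableSpace Ω := MeasurableSpace.comap (fun ω => (W ω, A ω)) inferInstance with hH
  set G : MeasurableSpace Ω := MeasurableSpace.comap W inferInstance with hG
  -- composition measurability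
  have measH : ∀ f : 𝒲 × ℝ → ℝ, Measurable f →
      StronglyMeasurable[H] (fun ω => f (W ω, A ω)) := by
    intro f hf
    exact (hf.comp (comap_measurable (fun ω => (W ω, A ω)))).stronglyMeasurable
  have measG : ∀ f : 𝒲 → ℝ, Measurable f → StronglyMeasurable[G] (fun ω => f (W ω)) := by
    intro f hf
    exact (hf.comp (comap_measurable W)).stronglyMeasurable
  let c : Ω → ℝ := fun ω => (2 * A ω - 1) / (if A ω = 1 then p (W ω) else 1 - p (W ω))
  let M : Ω → ℝ := fun ω => μ (A ω, W ω)
  let I : Ω → ℝ := fun ω => if A ω = 1 then 1 else 0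
  let J : Ω → ℝ := fun ω => 1 - I ω
  let g1 : Ω → ℝ := fun ω => (μ₀ (1, W ω) - μ (1, W ω)) / p (W ω)
  let g0 : Ω → ℝ := fun ω => (μ₀ (0, W ω) - μ (0, W ω)) / (1 - p (W ω))
  have hcm : StronglyMeasurable[H] c := by
    refine measH (fun x => (2 * x.2 - 1) / (if x.2 = 1 then p x.1 else 1 - p x.1)) ?_
    refine Measurable.div (by fun_prop) (Measurable.ite ?_ (by fun_prop) (by fun_prop))
    exact measurable_snd (measurableSet_singleton 1)
  have hMm : StronglyMeasurable[H] M := measH (fun x => μ (x.2, x.1)) (by fun_prop)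
  have hIm : Measurable[F] I :=
    Measurable.ite (hA (measurableSet_singleton 1)) measurable_const measurable_const
  have hJm : Measurable[F] J := measurable_const.sub hIm
  have hg1 : StronglyMeasurable[G] g1 :=
    measG (fun w => (μ₀ (1, w) - μ (1, w)) / p w) (by fun_prop)
  have hg0 : StronglyMeasurable[G] g0 :=
    measG (fun w => (μ₀ (0, w) - μ (0, w)) / (1 - p w)) (by fun_prop)
  have hIb : ∀ ω, ‖I ω‖ ≤ 1 := by
    intro ω; simp only [I]; split_ifs <;> simp
  have hJb : ∀ ω, ‖J ω‖ ≤ 1 := by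
    intro ω; simp only [J, I]; split_ifs <;> simp
  have hIi : Integrable I P := Integrable.of_bound hIm.aestronglyMeasurable 1 (ae_of_all _ hIb)
  have hJi : Integrable J P := Integrable.of_bound hJm.aestronglyMeasurable 1 (ae_of_all _ hJb)
  have hMi : Integrable M P :=
    Integrable.of_bound (hMm.mono hHle).aestronglyMeasurable cμ (ae_of_all _ fun ω => hcμ _)
  have hcb : ∀ ω, ‖c ω‖ ≤ 1 / δ := by
    intro ω
    obtain ⟨h1, h2⟩ := hp (W ω)
    simp only [c, norm_div, Real.norm_eq_abs]
    rcases hA01 ω with h | h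
    · have : |1 - p (W ω)| = 1 - p (W ω) := abs_of_pos (by linarith)
      simp only [h, zero_ne_one, if_false, this]
      norm_num
      rw [← one_div, ← one_div]
      exact one_div_le_one_div_of_le hδ (by linarith)
    · have : |p (W ω)| = p (W ω) := abs_of_pos (by linarith)
      simp only [h, if_true, this]
      norm_num
      rw [← one_div, ← one_div]
      exact one_div_le_one_div_of_le hδ (by linarith)
  have hE1 : P[c * (Y - M) | H] =ᵐ[P] c * P[Y - M | H] :=
    condExp_stronglyMeasurable_mul_of_bound hHle hcm (hYint.sub hMi) _ (ae_of_all _ hcb)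
  have hE2 : P[Y - M | H] =ᵐ[P] P[Y | H] - P[M | H] := condExp_sub hYint hMi H
  have hE3 : P[M | H] = M := condExp_of_stronglyMeasurable hHle hMm hMi
  have key : P[c * (Y - M) | H] =ᵐ[P] g1 * I - g0 * J := by
    filter_upwards [hE1, hE2, hμ₀] with ω e1 e2 e3
    rw [e1, Pi.mul_apply, e2, Pi.sub_apply, hE3, ← e3]
    simp only [c, M, I, J, g1, g0, Pi.sub_apply, Pi.mul_apply]
    rcases hA01 ω with h | h
    · simp [h]; ring
    · simp [h]; ring
  have hcond : Integrable (P[c * (Y - M) | H]) P := integrable_condExp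
  have hi1 : Integrable (g1 * I) P := by
    refine (hcond.bdd_mul hIm.aestronglyMeasurable (ae_of_all _ hIb)).congr ?_
    filter_upwards [key] with ω e
    rw [e]
    simp only [I, J, Pi.sub_apply, Pi.mul_apply]
    split_ifs <;> simp
  have hi0 : Integrable (g0 * J) P := by
    refine (hcond.bdd_mul hJm.aestronglyMeasurable (ae_of_all _ hJb)).neg.congr ?_
    filter_upwards [key] with ω e
    simp only [Pi.neg_apply]
    rw [e]
    simp only [I, J, Pi.sub_apply, Pi.mul_apply]
    split_ifs <;> simp
  have t1 : P[P[c * (Y - M) | H] | G] =ᵐ[P] P[c * (Y - M) | G] := condExp_condExp_of_le hGH hHle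
  have t2 : P[P[c * (Y - M) | H] | G] =ᵐ[P] P[g1 * I - g0 * J | G] := condExp_congr_ae key
  have t3 : P[g1 * I - g0 * J | G] =ᵐ[P] P[g1 * I | G] - P[g0 * J | G] := condExp_sub hi1 hi0 G
  have t4 : P[g1 * I | G] =ᵐ[P] g1 * P[I | G] :=
    condExp_mul_of_stronglyMeasurable_left hg1 hi1 hIi
  have t5 : P[g0 * J | G] =ᵐ[P] g0 * P[J | G] :=
    condExp_mul_of_stronglyMeasurable_left hg0 hi0 hJi
  have t6 : P[J | G] =ᵐ[P] P[fun _ => (1 : ℝ) | G] - P[I | G] :=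
    condExp_sub (integrable_const 1) hIi G
  have t7 : P[fun _ : Ω => (1 : ℝ) | G] = fun _ => 1 := condExp_const hGle 1
  have hp₀' : (fun ω => p₀ (W ω)) =ᵐ[P] P[I | G] := hp₀
  have main : ∀ᵐ ω ∂P,
        (μ (1, W ω) - μ (0, W ω)) - (μ₀ (1, W ω) - μ₀ (0, W ω))
          + (P[c * (Y - M) | G]) ω
        = (1 - p₀ (W ω) / p (W ω)) * (μ (1, W ω) - μ₀ (1, W ω))
          - (1 - (1 - p₀ (W ω)) / (1 - p (W ω))) * (μ (0, W ω) - μ₀ (0, W ω)) := by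
    filter_upwards [t1, t2, t3, t4, t5, t6, hp₀'] with ω e1 e2 e3 e4 e5 e6 e7
    rw [← e1, e2, e3, Pi.sub_apply, e4, e5, Pi.mul_apply, Pi.mul_apply, e6, Pi.sub_apply, t7, ← e7]
    simp only [g1, g0]
    ring
  refine ⟨main, fun h => ?_, fun h => ?_⟩
  · filter_upwards [main, h] with ω e1 e2
    refine e1.trans ?_
    obtain ⟨h1, h2⟩ := hp (W ω)
    rw [← e2, div_self (by linarith), div_self (by linarith)]
    ring
  · filter_upwards [main, h.1, h.2] with ω e1 e2 e3
    refine e1.trans ?_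
    rw [e2, e3]
    ring
end
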